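/- A lower bound in dimension 3: let f : (0,∞) → ℝ be four times continuously differentiable, non-decreasing and convex (f' ≥ 0 and f'' ≥ 0), and set F(x) = f(|x|) on ℝ³ \ {0}. Then for every smooth compactly supported u : ℝ³ → ℂ whose support does not contain the origin, − ∫_{ℝ³} conj(u) · ( Δ(Δ(F·u)) − 2Δ(F·Δu) + F·Δ(Δu) ) dx ≥ − ∫_{ℝ³} f''''(|x|) |u(x)|² dx. -/

import Mathlib

open scoped ComplexConjugate

/-- The Laplacian on `ℝ^d` (sum of second partial derivatives). -/
noncomputable def laplacian {d : ℕ} {F : Type*} [NormedAddCommGroup F] [NormedSpace ℝ F]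
    (u : EuclideanSpace ℝ (Fin d) → F) (x : EuclideanSpace ℝ (Fin d)) : F :=
  ∑ i, fderiv ℝ (fun y => fderiv ℝ u y (EuclideanSpace.single i 1)) x
    (EuclideanSpace.single i 1)

/-- The double commutator `[Δ,[Δ,F]]` applied to `u`:
`[Δ,[Δ,F]]u = Δ(Δ(F·u)) − 2Δ(F·Δu) + F·Δ(Δu)`. -/
noncomputable def doubleCommutator {d : ℕ} (f : EuclideanSpace ℝ (Fin d) → ℝ)
    (u : EuclideanSpace ℝ (Fin d) → ℂ) (x : EuclideanSpace ℝ (Fin d)) : ℂ :=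
  laplacian (laplacian (fun y => (f y : ℂ) * u y)) x
    - 2 * laplacian (fun y => (f y : ℂ) * laplacian u y) x
    + (f x : ℂ) * laplacian (laplacian u) x

/-- The `i`-th partial derivative of a complex-valued function on `ℝ^d`. -/
noncomputable def pderiv {d : ℕ} (i : Fin d) (w : EuclideanSpace ℝ (Fin d) → ℂ)
    (x : EuclideanSpace ℝ (Fin d)) : ℂ :=
  fderiv ℝ w x (EuclideanSpace.single i 1)

section pderiv

variable {d : ℕ} {i j : Fin d} {a b w : EuclideanSpace ℝ (Fin d) → ℂ}

lemma laplacian_eq_sum_pderiv (w : EuclideanSpace ℝ (Fin d) → ℂ) :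
    laplacian w = fun x => ∑ i, pderiv i (pderiv i w) x := rfl

lemma ContDiff.pderiv {m n : WithTop ℕ∞} (h : ContDiff ℝ n w) (hmn : m + 1 ≤ n) :
    ContDiff ℝ m (pderiv i w) :=
  (h.fderiv_right hmn).clm_apply contDiff_const

lemma pderiv_add (ha : ContDiff ℝ 1 a) (hb : ContDiff ℝ 1 b) :
    pderiv i (fun x => a x + b x) = fun x => pderiv i a x + pderiv i b x := by
  ext x
  simp only [pderiv]
  rw [fderiv_fun_add (ha.differentiable one_ne_zero x) (hb.differentiable one_ne_zero x)]
  rfl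

lemma pderiv_mul (ha : ContDiff ℝ 1 a) (hb : ContDiff ℝ 1 b) :
    pderiv i (fun x => a x * b x) = fun x => pderiv i a x * b x + a x * pderiv i b x := by
  ext x
  simp only [pderiv]
  rw [fderiv_fun_mul (ha.differentiable one_ne_zero x) (hb.differentiable one_ne_zero x)]
  simp
  ring

lemma pderiv_const_mul (c : ℂ) (ha : ContDiff ℝ 1 a) :
    pderiv i (fun x => c * a x) = fun x => c * pderiv i a x := by
  ext x
  simp only [pderiv]
  rw [fderiv_const_mul (ha.differentiable one_ne_zero x)]
  simp

lemma pderiv_sum {ι : Type*} (s : Finset ι) {A : ι → EuclideanSpace ℝ (Fin d) → ℂ}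
    (hA : ∀ k, ContDiff ℝ 1 (A k)) :
    pderiv i (fun x => ∑ k ∈ s, A k x) = fun x => ∑ k ∈ s, pderiv i (A k) x := by
  ext x
  simp only [pderiv]
  rw [fderiv_fun_sum fun k _ => (hA k).differentiable one_ne_zero x]
  simp

lemma pderiv_conj (ha : ContDiff ℝ 1 a) :
    pderiv i (fun x => conj (a x)) = fun x => conj (pderiv i a x) := by
  ext x
  have h := (Complex.conjCLE.toContinuousLinearMap.hasFDerivAt.comp x
    (ha.differentiable one_ne_zero x).hasFDerivAt).fderiv
  have h' : (fun x => conj (a x)) = (Complex.conjCLE.toContinuousLinearMap ∘ a) := by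
    ext x; simp
  simp only [pderiv]
  rw [h', h]
  simp

lemma pderiv_comm (hw : ContDiff ℝ 2 w) : pderiv i (pderiv j w) = pderiv j (pderiv i w) := by
  ext x
  have hd : DifferentiableAt ℝ (fderiv ℝ w) x :=
    (hw.fderiv_right (m := 1) (by norm_num)).differentiable one_ne_zero x
  have key (k : Fin d) : fderiv ℝ (pderiv k w) x =
      (fderiv ℝ (fderiv ℝ w) x).flip (EuclideanSpace.single k 1) := by
    have := fderiv_clm_apply hd (differentiableAt_const (EuclideanSpace.single k (1 : ℝ)))
    change fderiv ℝ (fun y => fderiv ℝ w y (EuclideanSpace.single k 1)) x = _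
    simpa using this
  have hs : IsSymmSndFDerivAt ℝ w x := hw.contDiffAt.isSymmSndFDerivAt (by simp)
  rw [pderiv, pderiv, key, key]
  exact hs _ _

lemma ContDiff.conj_comp {n : WithTop ℕ∞} (ha : ContDiff ℝ n a) :
    ContDiff ℝ n (fun x => conj (a x)) :=
  Complex.conjCLE.contDiff.comp ha

lemma pderiv_coord (i j : Fin d) :
    pderiv i (fun x => ((x j : ℝ) : ℂ)) = fun _ => if i = j then 1 else 0 := by
  ext x
  have h := ((Complex.ofRealCLM.comp (EuclideanSpace.proj (𝕜 := ℝ) j)).hasFDerivAt (x := x)).fderiv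
  have h' : (fun x : EuclideanSpace ℝ (Fin d) => ((x j : ℝ) : ℂ)) =
      Complex.ofRealCLM.comp (EuclideanSpace.proj (𝕜 := ℝ) j) := by
    ext x; simp
  rw [pderiv, h', h]
  by_cases hij : i = j
  · simp [hij]
  · simp [hij, Ne.symm hij]

lemma contDiff_coord {n : WithTop ℕ∞} (j : Fin d) :
    ContDiff ℝ n (fun x : EuclideanSpace ℝ (Fin d) => ((x j : ℝ) : ℂ)) :=
  (Complex.ofRealCLM.comp (EuclideanSpace.proj (𝕜 := ℝ) j)).contDiff

lemma contDiff_radial {n : WithTop ℕ∞} {φ : ℝ → ℝ} (hφ : ContDiff ℝ n φ) :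
    ContDiff ℝ n (fun x : EuclideanSpace ℝ (Fin d) => (φ (‖x‖ ^ 2) : ℂ)) :=
  Complex.ofRealCLM.contDiff.comp (hφ.comp (contDiff_norm_sq ℝ))

lemma pderiv_radial {φ : ℝ → ℝ} (hφ : ContDiff ℝ 1 φ) :
    pderiv i (fun x => (φ (‖x‖ ^ 2) : ℂ)) =
      fun x => 2 * ((x i : ℝ) : ℂ) * ((deriv φ (‖x‖ ^ 2) : ℝ) : ℂ) := by
  ext x
  have h1 := (hasStrictFDerivAt_norm_sq x).hasFDerivAt
  have h2 := (hφ.differentiable one_ne_zero (‖x‖ ^ 2)).hasDerivAt.comp_hasFDerivAt x h1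
  have h3 := (Complex.ofRealCLM.hasFDerivAt.comp x h2).fderiv
  have h' : (fun x : EuclideanSpace ℝ (Fin d) => (φ (‖x‖ ^ 2) : ℂ)) =
      (Complex.ofRealCLM ∘ (φ ∘ fun x => ‖x‖ ^ 2)) := by
    ext x; simp
  rw [pderiv, h', h3]
  simp [EuclideanSpace.inner_single_right]
  ring

lemma HasCompactSupport.pderiv (hw : HasCompactSupport w) : HasCompactSupport (pderiv i w) :=
  hw.fderiv_apply (𝕜 := ℝ) _

lemma integral_pderiv_eq_zero (hw : ContDiff ℝ 1 w) (hs : HasCompactSupport w) :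
    ∫ x, pderiv i w x = 0 := by
  have h := integral_mul_fderiv_eq_neg_fderiv_mul_of_integrable (𝕜 := ℂ)
    (μ := (MeasureTheory.volume : MeasureTheory.Measure (EuclideanSpace ℝ (Fin d))))
    (f := fun _ => (1 : ℂ)) (g := w) (v := EuclideanSpace.single i 1) (by simp)
    (by
      simp only [one_mul]
      exact (hw.pderiv (m := 0) (i := i) (by simp)).continuous.integrable_of_hasCompactSupport
        hs.pderiv)
    (by simpa using hw.continuous.integrable_of_hasCompactSupport hs)
    (by simp) (fun x _ => hw.differentiable one_ne_zero x)
  simpa [pderiv] using h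

lemma laplacian_mul (ha : ContDiff ℝ 2 a) (hb : ContDiff ℝ 2 b) :
    laplacian (fun x => a x * b x) = fun x =>
      laplacian a x * b x + 2 * (∑ i, pderiv i a x * pderiv i b x) + a x * laplacian b x := by
  have ha1 (i) : ContDiff ℝ 1 (pderiv i a) := ha.pderiv (by norm_num)
  have hb1 (i) : ContDiff ℝ 1 (pderiv i b) := hb.pderiv (by norm_num)
  have ha0 : ContDiff ℝ 1 a := ha.of_le (by norm_num)
  have hb0 : ContDiff ℝ 1 b := hb.of_le (by norm_num)
  ext x
  simp only [laplacian_eq_sum_pderiv, Finset.sum_mul, Finset.mul_sum, ← Finset.sum_add_distrib]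
  refine Finset.sum_congr rfl fun i _ => ?_
  rw [pderiv_mul ha0 hb0, pderiv_add ((ha1 i).mul hb0) (ha0.mul (hb1 i)),
    pderiv_mul (ha1 i) hb0, pderiv_mul ha0 (hb1 i)]
  ring

lemma laplacian_add (ha : ContDiff ℝ 2 a) (hb : ContDiff ℝ 2 b) :
    laplacian (fun x => a x + b x) = fun x => laplacian a x + laplacian b x := by
  ext x
  simp only [laplacian_eq_sum_pderiv, ← Finset.sum_add_distrib]
  refine Finset.sum_congr rfl fun i _ => ?_
  rw [pderiv_add (ha.of_le (by norm_num)) (hb.of_le (by norm_num)),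
    pderiv_add (ha.pderiv (by norm_num)) (hb.pderiv (by norm_num))]

lemma laplacian_const_mul (c : ℂ) (ha : ContDiff ℝ 2 a) :
    laplacian (fun x => c * a x) = fun x => c * laplacian a x := by
  ext x
  simp only [laplacian_eq_sum_pderiv, Finset.mul_sum]
  refine Finset.sum_congr rfl fun i _ => ?_
  rw [pderiv_const_mul c (ha.of_le (by norm_num)), pderiv_const_mul c (ha.pderiv (by norm_num))]

lemma laplacian_sum {ι : Type*} (s : Finset ι) {A : ι → EuclideanSpace ℝ (Fin d) → ℂ}
    (hA : ∀ k, ContDiff ℝ 2 (A k)) :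
    laplacian (fun x => ∑ k ∈ s, A k x) = fun x => ∑ k ∈ s, laplacian (A k) x := by
  ext x
  simp only [laplacian_eq_sum_pderiv]
  rw [Finset.sum_comm]
  refine Finset.sum_congr rfl fun i _ => ?_
  rw [pderiv_sum s fun k => (hA k).of_le (by norm_num),
    pderiv_sum s fun k => (hA k).pderiv (by norm_num)]

lemma ContDiff.laplacian {m n : WithTop ℕ∞} (h : ContDiff ℝ n w) (hmn : m + 2 ≤ n) :
    ContDiff ℝ m (laplacian w) := by
  rw [laplacian_eq_sum_pderiv]
  refine ContDiff.sum fun i _ => ?_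
  refine ContDiff.pderiv (n := m + 1) (ContDiff.pderiv (n := n) h ?_) le_rfl
  rwa [add_assoc, one_add_one_eq_two]

lemma pderiv_laplacian (hw : ContDiff ℝ 3 w) :
    pderiv i (laplacian w) = laplacian (pderiv i w) := by
  ext x
  simp only [laplacian_eq_sum_pderiv]
  rw [pderiv_sum]
  · refine Finset.sum_congr rfl fun k _ => ?_
    rw [pderiv_comm (i := i) (j := k) (hw.pderiv (by norm_num)),
      pderiv_comm (i := i) (j := k) (hw.of_le (by norm_num))]
  · exact fun k => ContDiff.pderiv (n := 2) (hw.pderiv (by norm_num)) (by norm_num)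

/-- The double commutator as a second order differential operator. -/
lemma laplacian_double_commutator {F u : EuclideanSpace ℝ (Fin d) → ℂ}
    (hF : ContDiff ℝ 4 F) (hu : ContDiff ℝ 4 u) (x : EuclideanSpace ℝ (Fin d)) :
    laplacian (laplacian (fun y => F y * u y)) x
      - 2 * laplacian (fun y => F y * laplacian u y) x + F x * laplacian (laplacian u) x =
    laplacian (laplacian F) x * u x + 4 * (∑ k, pderiv k (laplacian F) x * pderiv k u x)
      + 4 * ∑ k, ∑ i, pderiv i (pderiv k F) x * pderiv i (pderiv k u) x := by
  have hF2 : ContDiff ℝ 2 F := hF.of_le (by norm_num)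
  have hu2 : ContDiff ℝ 2 u := hu.of_le (by norm_num)
  have hLF : ContDiff ℝ 2 (laplacian F) := hF.laplacian (by norm_num)
  have hLu : ContDiff ℝ 2 (laplacian u) := hu.laplacian (by norm_num)
  have hPF (k) : ContDiff ℝ 2 (pderiv k F) := hF.pderiv (by norm_num)
  have hPu (k) : ContDiff ℝ 2 (pderiv k u) := hu.pderiv (by norm_num)
  have hS : ContDiff ℝ 2 (fun x => ∑ k, pderiv k F x * pderiv k u x) :=
    ContDiff.sum fun k _ => (hPF k).mul (hPu k)
  have e (k) := pderiv_laplacian (i := k) (hF.of_le (by norm_num : (3 : WithTop ℕ∞) ≤ 4))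
  have e' (k) := pderiv_laplacian (i := k) (hu.of_le (by norm_num : (3 : WithTop ℕ∞) ≤ 4))
  rw [laplacian_mul hF2 hu2, laplacian_mul hF2 hLu,
    laplacian_add ((hLF.mul hu2).add (contDiff_const.mul hS)) (hF2.mul hLu),
    laplacian_add (hLF.mul hu2) (contDiff_const.mul hS), laplacian_const_mul 2 hS,
    laplacian_sum _ fun k => (hPF k).mul (hPu k), laplacian_mul hLF hu2, laplacian_mul hF2 hLu]
  have e2 (k) := laplacian_mul (hPF k) (hPu k)
  simp only [e2, e, e', Finset.sum_add_distrib, ← Finset.mul_sum]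
  ring

end pderiv

lemma sum_pderiv_conj_mul_hessian {d : ℕ} {F u : EuclideanSpace ℝ (Fin d) → ℂ}
    (hF : ContDiff ℝ 4 F) (hu : ContDiff ℝ 4 u) (x : EuclideanSpace ℝ (Fin d)) :
    ∑ i, pderiv i (fun y => conj (u y) * ∑ k, pderiv i (pderiv k F) y * pderiv k u y) x =
      (∑ i, ∑ k, conj (pderiv i u x) * pderiv i (pderiv k F) x * pderiv k u x)
      + conj (u x) * (∑ k, pderiv k (laplacian F) x * pderiv k u x)
      + conj (u x) * ∑ k, ∑ i, pderiv i (pderiv k F) x * pderiv i (pderiv k u) x := by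
  have hu1 : ContDiff ℝ 1 u := hu.of_le (by norm_num)
  have hPu (k) : ContDiff ℝ 1 (pderiv k u) := hu.pderiv (by norm_num)
  have hH (i k) : ContDiff ℝ 1 (pderiv i (pderiv k F)) :=
    ContDiff.pderiv (n := 2) (hF.pderiv (by norm_num)) (by norm_num)
  have e (k) : pderiv k (laplacian F) x = ∑ i, pderiv i (pderiv i (pderiv k F)) x := by
    rw [pderiv_laplacian (hF.of_le (by norm_num))]; rfl
  have e1 (i) : pderiv i (fun y => conj (u y) * ∑ k, pderiv i (pderiv k F) y * pderiv k u y) x =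
      ∑ k, (conj (pderiv i u x) * pderiv i (pderiv k F) x * pderiv k u x
        + conj (u x) * (pderiv i (pderiv i (pderiv k F)) x * pderiv k u x)
        + conj (u x) * (pderiv i (pderiv k F) x * pderiv i (pderiv k u) x)) := by
    rw [pderiv_mul hu1.conj_comp (ContDiff.sum fun k _ => (hH i k).mul (hPu k)),
      pderiv_sum _ fun k => (hH i k).mul (hPu k), pderiv_conj hu1]
    simp only [Finset.mul_sum, ← Finset.sum_add_distrib]
    refine Finset.sum_congr rfl fun k _ => ?_
    rw [pderiv_mul (hH i k) (hPu k)]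
    ring
  simp only [e1, e, Finset.sum_add_distrib]
  simp only [Finset.mul_sum, Finset.sum_mul]
  rw [Finset.sum_comm (f := fun i k => conj (u x) *
      (pderiv i (pderiv i (pderiv k F)) x * pderiv k u x)),
    Finset.sum_comm (f := fun i k => conj (u x) *
      (pderiv i (pderiv k F) x * pderiv i (pderiv k u) x))]

lemma sum_pderiv_coord_mul_radial {d : ℕ} {p : ℝ → ℝ} {u : EuclideanSpace ℝ (Fin d) → ℂ}
    (hp : ContDiff ℝ 1 p) (hu : ContDiff ℝ 1 u) (x : EuclideanSpace ℝ (Fin d)) :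
    ∑ i, pderiv i (fun y => ((y i : ℝ) : ℂ) * ((p (‖y‖ ^ 2) : ℂ) * (conj (u y) * u y))) x =
      (2 * (∑ i, ((x i : ℝ) : ℂ) ^ 2) * ((deriv p (‖x‖ ^ 2) : ℝ) : ℂ) + d * (p (‖x‖ ^ 2) : ℂ))
        * (conj (u x) * u x)
      + (p (‖x‖ ^ 2) : ℂ) * (conj (∑ i, ((x i : ℝ) : ℂ) * pderiv i u x) * u x
        + conj (u x) * ∑ i, ((x i : ℝ) : ℂ) * pderiv i u x) := by
  have hR := contDiff_radial (d := d) hp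
  have e (i) : pderiv i (fun y => ((y i : ℝ) : ℂ) * ((p (‖y‖ ^ 2) : ℂ) * (conj (u y) * u y))) x =
      (2 * ((x i : ℝ) : ℂ) ^ 2 * ((deriv p (‖x‖ ^ 2) : ℝ) : ℂ) + (p (‖x‖ ^ 2) : ℂ))
        * (conj (u x) * u x)
      + (p (‖x‖ ^ 2) : ℂ) * (conj (((x i : ℝ) : ℂ) * pderiv i u x) * u x
        + conj (u x) * (((x i : ℝ) : ℂ) * pderiv i u x)) := by
    rw [pderiv_mul (contDiff_coord i) (hR.mul (hu.conj_comp.mul hu)), pderiv_coord,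
      pderiv_mul hR (hu.conj_comp.mul hu), pderiv_radial hp, pderiv_mul hu.conj_comp hu,
      pderiv_conj hu]
    simp
    ring
  simp only [e, map_sum, Finset.mul_sum, Finset.sum_mul, Finset.sum_add_distrib, mul_add, add_mul]
  simp
  ring

lemma pderiv_pderiv_radial {d : ℕ} {g : ℝ → ℝ} (hg : ContDiff ℝ 2 g) (i k : Fin d) :
    pderiv i (pderiv k (fun x => (g (‖x‖ ^ 2) : ℂ))) = fun x =>
      (if i = k then 2 * ((deriv g (‖x‖ ^ 2) : ℝ) : ℂ) else 0)
        + 4 * ((x i : ℝ) : ℂ) * ((x k : ℝ) : ℂ) * ((deriv (deriv g) (‖x‖ ^ 2) : ℝ) : ℂ) := by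
  have hg1 : ContDiff ℝ 1 (deriv g) := hg.deriv'
  have hX := contDiff_coord (n := 1) k
  rw [pderiv_radial (hg.of_le (by norm_num)), pderiv_mul (contDiff_const.mul hX)
    (contDiff_radial hg1), pderiv_const_mul 2 hX, pderiv_coord, pderiv_radial hg1]
  ext x
  split_ifs <;> ring

lemma sum_coord_sq {d : ℕ} (x : EuclideanSpace ℝ (Fin d)) :
    ∑ i, ((x i : ℝ) : ℂ) ^ 2 = ((‖x‖ ^ 2 : ℝ) : ℂ) := by
  rw [EuclideanSpace.real_norm_sq_eq]
  push_cast
  rfl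

lemma laplacian_radial {d : ℕ} {g : ℝ → ℝ} (hg : ContDiff ℝ 2 g) :
    laplacian (fun x : EuclideanSpace ℝ (Fin d) => (g (‖x‖ ^ 2) : ℂ)) = fun x =>
      (((fun s => 2 * d * deriv g s + 4 * s * deriv (deriv g) s) (‖x‖ ^ 2) : ℝ) : ℂ) := by
  ext x
  simp only [laplacian_eq_sum_pderiv, pderiv_pderiv_radial hg]
  push_cast
  have h := sum_coord_sq x
  push_cast at h
  rw [← h]
  simp [Finset.sum_add_distrib, Finset.mul_sum, Finset.sum_mul]
  ring_nf
  congr 1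
  exact Finset.sum_congr rfl fun _ _ => by ring

lemma laplacian_laplacian_radial {g : ℝ → ℝ} (hg : ContDiff ℝ 4 g) (x : EuclideanSpace ℝ (Fin 3)) :
    laplacian (laplacian (fun x : EuclideanSpace ℝ (Fin 3) => (g (‖x‖ ^ 2) : ℂ))) x =
      ((60 * deriv (deriv g) (‖x‖ ^ 2) + 80 * ‖x‖ ^ 2 * deriv (deriv (deriv g)) (‖x‖ ^ 2)
        + 16 * (‖x‖ ^ 2) ^ 2 * deriv (deriv (deriv (deriv g))) (‖x‖ ^ 2) : ℝ) : ℂ) := by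
  have h1 : ContDiff ℝ 3 (deriv g) := hg.deriv'
  have h2 : ContDiff ℝ 2 (deriv (deriv g)) := h1.deriv'
  have h3 : ContDiff ℝ 1 (deriv (deriv (deriv g))) := h2.deriv'
  have d1 (s) := (h1.differentiable (by norm_num) s).hasDerivAt
  have d2 (s) := (h2.differentiable (by norm_num) s).hasDerivAt
  have d3 (s) := (h3.differentiable (by norm_num) s).hasDerivAt
  have hh : ContDiff ℝ 2 (fun s => 2 * ((3 : ℕ) : ℝ) * deriv g s + 4 * s * deriv (deriv g) s) :=
    (contDiff_const.mul (h1.of_le (by norm_num))).add ((contDiff_const.mul contDiff_id).mul h2)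
  have e1 : deriv (fun s => 2 * ((3 : ℕ) : ℝ) * deriv g s + 4 * s * deriv (deriv g) s) =
      fun s => 10 * deriv (deriv g) s + 4 * s * deriv (deriv (deriv g)) s := by
    ext s
    refine (((d1 s).const_mul _).add
      (((hasDerivAt_id s).const_mul 4).mul (d2 s))).deriv.trans ?_
    simp
    ring
  have e2 : deriv (fun s => 10 * deriv (deriv g) s + 4 * s * deriv (deriv (deriv g)) s) =
      fun s => 14 * deriv (deriv (deriv g)) s + 4 * s * deriv (deriv (deriv (deriv g))) s := by
    ext s
    refine (((d2 s).const_mul _).add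
      (((hasDerivAt_id s).const_mul 4).mul (d3 s))).deriv.trans ?_
    simp
    ring
  rw [laplacian_radial (hg.of_le (by norm_num)), laplacian_radial hh, e1, e2]
  push_cast
  ring

lemma hardy_pointwise_nonneg {s G₁ G₂ P x₀ x₁ x₂ a₀ a₁ a₂ b₀ b₁ b₂ a b : ℝ}
    (hs : 0 < s) (hx : s = x₀ ^ 2 + x₁ ^ 2 + x₂ ^ 2) (hP : P * s = 2 * G₁ + 4 * s * G₂)
    (hG₁ : 0 ≤ G₁) (hP0 : 0 ≤ P) :
    0 ≤ 2 * G₁ * (a₀ ^ 2 + a₁ ^ 2 + a₂ ^ 2 + b₀ ^ 2 + b₁ ^ 2 + b₂ ^ 2)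
      + 4 * G₂ * ((x₀ * a₀ + x₁ * a₁ + x₂ * a₂) ^ 2 + (x₀ * b₀ + x₁ * b₁ + x₂ * b₂) ^ 2)
      + P * (a ^ 2 + b ^ 2)
      + 2 * P * (a * (x₀ * a₀ + x₁ * a₁ + x₂ * a₂) + b * (x₀ * b₀ + x₁ * b₁ + x₂ * b₂)) := by
  refine nonneg_of_mul_nonneg_right (a := s) ?_ hs
  have key : 0 ≤ 2 * G₁ * ((x₀ * a₁ - x₁ * a₀) ^ 2 + (x₀ * a₂ - x₂ * a₀) ^ 2
        + (x₁ * a₂ - x₂ * a₁) ^ 2 + (x₀ * b₁ - x₁ * b₀) ^ 2 + (x₀ * b₂ - x₂ * b₀) ^ 2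
        + (x₁ * b₂ - x₂ * b₁) ^ 2)
      + s * P * ((a + (x₀ * a₀ + x₁ * a₁ + x₂ * a₂)) ^ 2
        + (b + (x₀ * b₀ + x₁ * b₁ + x₂ * b₂)) ^ 2) := by
    positivity
  refine key.trans_eq ?_
  have hL : (x₀ * a₁ - x₁ * a₀) ^ 2 + (x₀ * a₂ - x₂ * a₀) ^ 2
        + (x₁ * a₂ - x₂ * a₁) ^ 2 + (x₀ * b₁ - x₁ * b₀) ^ 2 + (x₀ * b₂ - x₂ * b₀) ^ 2
        + (x₁ * b₂ - x₂ * b₁) ^ 2 = s * (a₀ ^ 2 + a₁ ^ 2 + a₂ ^ 2 + b₀ ^ 2 + b₁ ^ 2 + b₂ ^ 2)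
        - ((x₀ * a₀ + x₁ * a₁ + x₂ * a₂) ^ 2 + (x₀ * b₀ + x₁ * b₁ + x₂ * b₂) ^ 2) := by
    rw [hx]; ring
  rw [hL]
  linear_combination ((x₀ * a₀ + x₁ * a₁ + x₂ * a₂) ^ 2 + (x₀ * b₀ + x₁ * b₁ + x₂ * b₂) ^ 2) * hP

/-- The pointwise inequality between the double commutator density, corrected by divergences,
and the fourth derivative potential. -/
lemma re_density_le {s G₁ G₂ G₃ G₄ P P' x₀ x₁ x₂ : ℝ} {U U₀ U₁ U₂ : ℂ}
    (hs : 0 < s) (hx : s = x₀ ^ 2 + x₁ ^ 2 + x₂ ^ 2) (hP : P * s = 2 * G₁ + 4 * s * G₂)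
    (hP' : P' * s + P = 6 * G₂ + 4 * s * G₃) (hG₁ : 0 ≤ G₁) (hP0 : 0 ≤ P) :
    (((60 * G₂ + 80 * s * G₃ + 16 * s ^ 2 * G₄ : ℝ) : ℂ) * (conj U * U)
      - 4 * (2 * G₁ * (conj U₀ * U₀ + conj U₁ * U₁ + conj U₂ * U₂)
        + 4 * G₂ * (conj (x₀ * U₀ + x₁ * U₁ + x₂ * U₂) * (x₀ * U₀ + x₁ * U₁ + x₂ * U₂)))
      - 4 * ((2 * s * P' + 3 * P) * (conj U * U)
        + P * (conj (x₀ * U₀ + x₁ * U₁ + x₂ * U₂) * U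
          + conj U * (x₀ * U₀ + x₁ * U₁ + x₂ * U₂)))).re
      ≤ (12 * G₂ + 48 * s * G₃ + 16 * s ^ 2 * G₄) * ‖U‖ ^ 2 := by
  have key := hardy_pointwise_nonneg (a₀ := U₀.re) (a₁ := U₁.re) (a₂ := U₂.re) (b₀ := U₀.im)
    (b₁ := U₁.im) (b₂ := U₂.im) (a := U.re) (b := U.im) hs hx hP hG₁ hP0
  rw [← Complex.normSq_eq_norm_sq, Complex.normSq_apply]
  simp only [← Complex.ofReal_ofNat, ← Complex.ofReal_mul, ← Complex.ofReal_add, Complex.sub_re,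
    Complex.add_re, map_add, map_mul, Complex.conj_ofReal, Complex.mul_re,
    Complex.mul_im, Complex.add_im, Complex.conj_re, Complex.conj_im,
    Complex.ofReal_re, Complex.ofReal_im]
  rw [← sub_nonneg]
  refine (mul_nonneg (by norm_num : (0 : ℝ) ≤ 4) key).trans_eq ?_
  linear_combination hP' * (-8 * (U.re ^ 2 + U.im ^ 2))

/-- The lower bound for a weight that is a globally smooth function of `‖x‖ ^ 2`. -/
lemma radial_lower_bound_of_contDiff {ε : ℝ} (hε : 0 < ε) {g p : ℝ → ℝ}
    (hg : ContDiff ℝ 4 g) (hp : ContDiff ℝ 1 p)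
    (hpg : ∀ s, ε < s → p s * s = 2 * deriv g s + 4 * s * deriv (deriv g) s)
    (hg1 : ∀ s, ε < s → 0 ≤ deriv g s) (hp0 : ∀ s, ε < s → 0 ≤ p s)
    {u : EuclideanSpace ℝ (Fin 3) → ℂ} (hu : ContDiff ℝ 4 u) (hsupp : HasCompactSupport u)
    (hε_supp : ∀ x ∈ tsupport u, ε < ‖x‖ ^ 2) :
    (- ∫ x : EuclideanSpace ℝ (Fin 3),
        conj (u x) * doubleCommutator (fun y => g (‖y‖ ^ 2)) u x).re ≥
      - ∫ x : EuclideanSpace ℝ (Fin 3), (12 * deriv (deriv g) (‖x‖ ^ 2)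
        + 48 * ‖x‖ ^ 2 * deriv (deriv (deriv g)) (‖x‖ ^ 2)
        + 16 * (‖x‖ ^ 2) ^ 2 * deriv (deriv (deriv (deriv g))) (‖x‖ ^ 2)) * ‖u x‖ ^ 2 := by
  have h1 : ContDiff ℝ 3 (deriv g) := hg.deriv'
  have h2 : ContDiff ℝ 2 (deriv (deriv g)) := h1.deriv'
  have h3 : ContDiff ℝ 1 (deriv (deriv (deriv g))) := h2.deriv'
  have h4 : ContDiff ℝ 0 (deriv (deriv (deriv (deriv g)))) := h3.deriv'
  have hF := contDiff_radial (d := 3) hg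
  set F : EuclideanSpace ℝ (Fin 3) → ℂ := fun y => (g (‖y‖ ^ 2) : ℂ) with hFdef
  have hu1 : ContDiff ℝ 1 u := hu.of_le (by norm_num)
  have hPu (k) : ContDiff ℝ 1 (pderiv k u) := hu.pderiv (by norm_num)
  have hH (i k) : ContDiff ℝ 1 (pderiv i (pderiv k F)) :=
    ContDiff.pderiv (n := 2) (hF.pderiv (by norm_num)) (by norm_num)
  set V : Fin 3 → EuclideanSpace ℝ (Fin 3) → ℂ :=
    fun i y => conj (u y) * ∑ k, pderiv i (pderiv k F) y * pderiv k u y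
  set W : Fin 3 → EuclideanSpace ℝ (Fin 3) → ℂ :=
    fun i y => ((y i : ℝ) : ℂ) * ((p (‖y‖ ^ 2) : ℂ) * (conj (u y) * u y))
  have hVc (i) : ContDiff ℝ 1 (V i) :=
    hu1.conj_comp.mul (ContDiff.sum fun k _ => (hH i k).mul (hPu k))
  have hWc (i) : ContDiff ℝ 1 (W i) :=
    (contDiff_coord i).mul ((contDiff_radial hp).mul (hu1.conj_comp.mul hu1))
  have hVs (i) : HasCompactSupport (V i) := hsupp.mono' <| by
    refine subset_trans (fun x hx => ?_) subset_closure
    contrapose! hx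
    simp_all [V]
  have hWs (i) : HasCompactSupport (W i) := hsupp.mono' <| by
    refine subset_trans (fun x hx => ?_) subset_closure
    contrapose! hx
    simp_all [W]
  have intV (i) : MeasureTheory.Integrable (pderiv i (V i)) :=
    ((hVc i).pderiv (m := 0) (by simp)).continuous.integrable_of_hasCompactSupport (hVs i).pderiv
  have intW (i) : MeasureTheory.Integrable (pderiv i (W i)) :=
    ((hWc i).pderiv (m := 0) (by simp)).continuous.integrable_of_hasCompactSupport (hWs i).pderiv
  set T : EuclideanSpace ℝ (Fin 3) → ℂ :=
    fun x => 4 * (∑ i, pderiv i (V i) x) + 4 * ∑ i, pderiv i (W i) x with hT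
  have intT : MeasureTheory.Integrable T :=
    ((MeasureTheory.integrable_finsetSum _ fun i _ => intV i).const_mul 4).add
      ((MeasureTheory.integrable_finsetSum _ fun i _ => intW i).const_mul 4)
  have zeroT : ∫ x, T x = 0 := by
    rw [hT, MeasureTheory.integral_add
      ((MeasureTheory.integrable_finsetSum _ fun i _ => intV i).const_mul 4)
      ((MeasureTheory.integrable_finsetSum _ fun i _ => intW i).const_mul 4),
      MeasureTheory.integral_const_mul, MeasureTheory.integral_const_mul,
      MeasureTheory.integral_finsetSum _ fun i _ => intV i,
      MeasureTheory.integral_finsetSum _ fun i _ => intW i]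
    simp [integral_pderiv_eq_zero (hVc _) (hVs _), integral_pderiv_eq_zero (hWc _) (hWs _)]
  set D : EuclideanSpace ℝ (Fin 3) → ℂ :=
    fun x => conj (u x) * doubleCommutator (fun y => g (‖y‖ ^ 2)) u x with hD
  have hDC : doubleCommutator (fun y => g (‖y‖ ^ 2)) u = fun x =>
      laplacian (laplacian F) x * u x + 4 * (∑ k, pderiv k (laplacian F) x * pderiv k u x)
      + 4 * ∑ k, ∑ i, pderiv i (pderiv k F) x * pderiv i (pderiv k u) x := by
    ext x
    exact laplacian_double_commutator hF hu x
  have intD : MeasureTheory.Integrable D := by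
    refine Continuous.integrable_of_hasCompactSupport ?_ ?_
    · rw [hD, hDC]
      have hLF : ContDiff ℝ 2 (laplacian F) := hF.laplacian (by norm_num)
      refine hu1.conj_comp.continuous.mul (((Continuous.mul ?_ hu.continuous).add
        (continuous_const.mul (continuous_finsetSum _ fun k _ => ?_))).add
        (continuous_const.mul (continuous_finsetSum _ fun k _ => continuous_finsetSum _
          fun i _ => ?_)))
      · exact (hLF.laplacian (m := 0) (by simp)).continuous
      · exact (hLF.pderiv (m := 1) (by norm_num)).continuous.mul (hPu k).continuous
      · exact (hH i k).continuous.mul ((hPu k).pderiv (m := 0) (by simp)).continuous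
    · refine hsupp.mono' <| subset_trans (fun x hx => ?_) subset_closure
      contrapose! hx
      simp_all [D]
  have intQ : MeasureTheory.Integrable fun x : EuclideanSpace ℝ (Fin 3) =>
      (12 * deriv (deriv g) (‖x‖ ^ 2)
        + 48 * ‖x‖ ^ 2 * deriv (deriv (deriv g)) (‖x‖ ^ 2)
        + 16 * (‖x‖ ^ 2) ^ 2 * deriv (deriv (deriv (deriv g))) (‖x‖ ^ 2)) * ‖u x‖ ^ 2 := by
    refine Continuous.integrable_of_hasCompactSupport ?_ ?_
    · have c2 := h2.continuous
      have c3 := h3.continuous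
      have c4 := h4.continuous
      have cu := hu.continuous
      fun_prop
    · refine hsupp.mono' <| subset_trans (fun x hx => ?_) subset_closure
      contrapose! hx
      simp_all
  have pointwise (x) : (D x - T x).re ≤ (12 * deriv (deriv g) (‖x‖ ^ 2)
        + 48 * ‖x‖ ^ 2 * deriv (deriv (deriv g)) (‖x‖ ^ 2)
        + 16 * (‖x‖ ^ 2) ^ 2 * deriv (deriv (deriv (deriv g))) (‖x‖ ^ 2)) * ‖u x‖ ^ 2 := by
    have hTx : T x = 4 * (∑ i, pderiv i (V i) x) + 4 * ∑ i, pderiv i (W i) x := rfl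
    rw [sum_pderiv_conj_mul_hessian hF hu x, sum_pderiv_coord_mul_radial hp hu1 x,
      sum_coord_sq] at hTx
    have hDx : D x = conj (u x) * doubleCommutator (fun y => g (‖y‖ ^ 2)) u x := rfl
    rw [hDC] at hDx
    by_cases hx : x ∈ tsupport u
    · have hs := hε_supp x hx
      have hs0 : 0 < ‖x‖ ^ 2 := hε.trans hs
      have hnorm : ‖x‖ ^ 2 = x 0 ^ 2 + x 1 ^ 2 + x 2 ^ 2 := by
        rw [EuclideanSpace.real_norm_sq_eq, Fin.sum_univ_three]
      have hp' : deriv p (‖x‖ ^ 2) * ‖x‖ ^ 2 + p (‖x‖ ^ 2) =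
          6 * deriv (deriv g) (‖x‖ ^ 2) + 4 * ‖x‖ ^ 2 * deriv (deriv (deriv g)) (‖x‖ ^ 2) := by
        generalize ‖x‖ ^ 2 = s at hs
        have dp := (hp.differentiable one_ne_zero s).hasDerivAt.mul (hasDerivAt_id s)
        have dg := ((h1.differentiable (by norm_num) s).hasDerivAt.const_mul 2).add
          (((hasDerivAt_id s).const_mul 4).mul (h2.differentiable (by norm_num) s).hasDerivAt)
        have e := Filter.EventuallyEq.deriv_eq (Filter.eventually_of_mem (Ioi_mem_nhds hs) hpg)
        have e' := dp.deriv.symm.trans (e.trans dg.deriv)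
        simp at e'
        linear_combination e'
      have key := re_density_le (G₄ := deriv (deriv (deriv (deriv g))) (‖x‖ ^ 2)) (U := u x)
        (U₀ := pderiv 0 u x) (U₁ := pderiv 1 u x) (U₂ := pderiv 2 u x) hs0 hnorm
        (hpg _ hs) hp' (hg1 _ hs) (hp0 _ hs)
      refine le_of_eq_of_le ?_ key
      congr 1
      rw [hDx, hTx]
      simp only [hFdef, laplacian_laplacian_radial hg,
        pderiv_pderiv_radial (hg.of_le (by norm_num : (2 : WithTop ℕ∞) ≤ 4))]
      generalize pderiv _ (laplacian _) = Y
      simp only [Fin.sum_univ_three, map_add, map_mul, Complex.conj_ofReal]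
      simp
      ring
    · have u0 : u x = 0 := image_eq_zero_of_notMem_tsupport hx
      have u1 (i) : pderiv i u x = 0 := by
        have := fderiv_of_notMem_tsupport (𝕜 := ℝ) hx
        simp [pderiv, this]
      rw [hDx, hTx]
      simp [u0, u1]
  have hle : (∫ x, D x).re ≤ ∫ x : EuclideanSpace ℝ (Fin 3), (12 * deriv (deriv g) (‖x‖ ^ 2)
        + 48 * ‖x‖ ^ 2 * deriv (deriv (deriv g)) (‖x‖ ^ 2)
        + 16 * (‖x‖ ^ 2) ^ 2 * deriv (deriv (deriv (deriv g))) (‖x‖ ^ 2)) * ‖u x‖ ^ 2 := by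
    have hDT : ∫ x, D x = ∫ x, (D x - T x) := by
      rw [MeasureTheory.integral_sub intD intT, zeroT, sub_zero]
    have hre : (∫ x, (D x - T x)).re = ∫ x, (D x - T x).re :=
      (integral_re (𝕜 := ℂ) (intD.sub intT)).symm
    rw [hDT, hre]
    exact MeasureTheory.integral_mono (intD.sub intT).re intQ pointwise
  rw [Complex.neg_re]
  exact neg_le_neg hle

/-- A function that is smooth on the positive half-line can be modified near the origin to become
smooth on the whole line. -/
lemma exists_contDiff_eq_of_contDiffOn_Ioi {n : ℕ} {φ : ℝ → ℝ}
    (hφ : ContDiffOn ℝ n φ (Set.Ioi 0)) {ε : ℝ} (hε : 0 < ε) :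
    ∃ g : ℝ → ℝ, ContDiff ℝ n g ∧ ∀ s, ε < s → g s = φ s := by
  set χ : ℝ → ℝ := fun s => Real.smoothTransition (2 * s / ε - 1)
  have hχc : ContDiff ℝ n χ :=
    Real.smoothTransition.contDiff.comp
      (((contDiff_const.mul contDiff_id).div_const _).sub contDiff_const)
  refine ⟨fun s => χ s * φ s, contDiff_iff_contDiffAt.2 fun s => ?_, fun s hs => ?_⟩
  · rcases lt_or_ge s (ε / 2) with h | h
    · refine (contDiffAt_const (c := (0 : ℝ))).congr_of_eventuallyEq ?_
      filter_upwards [Iio_mem_nhds h] with t ht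
      have : χ t = 0 := by
        refine Real.smoothTransition.zero_of_nonpos ?_
        rw [sub_nonpos, div_le_one hε]
        linarith [Set.mem_Iio.1 ht]
      simp [this]
    · exact hχc.contDiffAt.mul (hφ.contDiffAt (Ioi_mem_nhds (by linarith)))
  · have : χ s = 1 := by
      refine Real.smoothTransition.one_of_one_le ?_
      rw [le_sub_iff_add_le, le_div_iff₀ hε]
      linarith
    simp [this]

/-- Derivatives of `r ↦ g (r ^ 2)`. -/
lemma derivs_comp_sq {f g : ℝ → ℝ} (hg : ContDiff ℝ 4 g) {O : Set ℝ} (hO : IsOpen O)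
    (h : Set.EqOn f (fun r => g (r ^ 2)) O) {r : ℝ} (hr : r ∈ O) :
    deriv f r = 2 * r * deriv g (r ^ 2) ∧
    deriv (deriv f) r = 2 * deriv g (r ^ 2) + 4 * r ^ 2 * deriv (deriv g) (r ^ 2) ∧
    iteratedDeriv 4 f r = 12 * deriv (deriv g) (r ^ 2)
        + 48 * r ^ 2 * deriv (deriv (deriv g)) (r ^ 2)
        + 16 * (r ^ 2) ^ 2 * deriv (deriv (deriv (deriv g))) (r ^ 2) := by
  have h1 : ContDiff ℝ 3 (deriv g) := hg.deriv'
  have h2 : ContDiff ℝ 2 (deriv (deriv g)) := h1.deriv'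
  have h3 : ContDiff ℝ 1 (deriv (deriv (deriv g))) := h2.deriv'
  have sq (r : ℝ) : HasDerivAt (fun r : ℝ => r ^ 2) (2 * r) r := by
    simpa using hasDerivAt_pow 2 r
  have comp {φ : ℝ → ℝ} (hφ : ContDiff ℝ 1 φ) (r : ℝ) :
      HasDerivAt (fun r => φ (r ^ 2)) (deriv φ (r ^ 2) * (2 * r)) r :=
    (hφ.differentiable one_ne_zero (r ^ 2)).hasDerivAt.comp r (sq r)
  have d0 := comp (hg.of_le (by norm_num))
  have d1 := comp (h1.of_le (by norm_num))
  have d2 := comp (h2.of_le (by norm_num))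
  have d3 := comp h3
  have e1 : Set.EqOn (deriv f) (fun r => 2 * r * deriv g (r ^ 2)) O := fun r hr =>
    (h.deriv hO hr).trans ((d0 r).deriv.trans (by ring))
  have e2 : Set.EqOn (deriv (deriv f))
      (fun r => 2 * deriv g (r ^ 2) + 4 * r ^ 2 * deriv (deriv g) (r ^ 2)) O := fun r hr =>
    (e1.deriv hO hr).trans ((((hasDerivAt_id r).const_mul 2).mul (d1 r)).deriv.trans
      (by simp; ring))
  have e3 : Set.EqOn (deriv (deriv (deriv f)))
      (fun r => 12 * r * deriv (deriv g) (r ^ 2)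
        + 8 * r ^ 3 * deriv (deriv (deriv g)) (r ^ 2)) O := fun r hr =>
    (e2.deriv hO hr).trans ((((d1 r).const_mul 2).add
      (((sq r).const_mul 4).mul (d2 r))).deriv.trans (by ring))
  have e4 : Set.EqOn (deriv (deriv (deriv (deriv f))))
      (fun r => 12 * deriv (deriv g) (r ^ 2) + 48 * r ^ 2 * deriv (deriv (deriv g)) (r ^ 2)
        + 16 * (r ^ 2) ^ 2 * deriv (deriv (deriv (deriv g))) (r ^ 2)) O := fun r hr =>
    (e3.deriv hO hr).trans (((((hasDerivAt_id r).const_mul 12).mul (d2 r)).add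
      (((hasDerivAt_pow 3 r).const_mul 8).mul (d3 r))).deriv.trans (by simp; ring))
  refine ⟨e1 hr, e2 hr, ?_⟩
  rw [iteratedDeriv_eq_iterate]
  exact e4 hr

lemma laplacian_of_notMem_tsupport {d : ℕ} {u : EuclideanSpace ℝ (Fin d) → ℂ}
    {x : EuclideanSpace ℝ (Fin d)} (hx : x ∉ tsupport u) : laplacian u x = 0 := by
  refine Finset.sum_eq_zero fun i _ => ?_
  have hx' : x ∉ tsupport (fun y => fderiv ℝ u y (EuclideanSpace.single i 1)) :=
    fun h => hx (tsupport_fderiv_apply_subset ℝ _ h)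
  rw [fderiv_of_notMem_tsupport ℝ hx']
  rfl

/-- `doubleCommutator` only depends on the values of the weight on the support of `u`. -/
lemma doubleCommutator_congr {d : ℕ} {F G : EuclideanSpace ℝ (Fin d) → ℝ}
    {u : EuclideanSpace ℝ (Fin d) → ℂ} (h : Set.EqOn F G (tsupport u)) :
    doubleCommutator F u = doubleCommutator G u := by
  have tsub : tsupport (laplacian u) ⊆ tsupport u :=
    closure_minimal (fun x hx => by
      by_contra hxu
      exact hx (laplacian_of_notMem_tsupport hxu)) (isClosed_tsupport u)
  have key {w : EuclideanSpace ℝ (Fin d) → ℂ} (hw : tsupport w ⊆ tsupport u) (y) :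
      (F y : ℂ) * w y = (G y : ℂ) * w y := by
    by_cases hy : y ∈ tsupport w
    · rw [h (hw hy)]
    · simp [image_eq_zero_of_notMem_tsupport hy]
  have tsub2 : tsupport (laplacian (laplacian u)) ⊆ tsupport u :=
    closure_minimal (fun x hx => by
      by_contra hxu
      exact hx (laplacian_of_notMem_tsupport fun h => hxu (tsub h))) (isClosed_tsupport u)
  ext x
  simp only [doubleCommutator, key subset_rfl, key tsub, key tsub2]

/-- A lower bound for `d = 3` (eq:simple-bound-1D-3D): for a non-decreasing,
convex, `C⁴` radial weight `f(|x|)`, one has `−[Δ,[Δ,f(|x|)]] ≥ −f⁗(|x|)`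
as quadratic forms on `C_c^∞(ℝ³ \ {0})`. -/
theorem double_commutator_radial_lower_bound_3d
    (f : ℝ → ℝ) (hf : ContDiffOn ℝ 4 f (Set.Ioi 0))
    (hf' : ∀ r : ℝ, 0 < r → 0 ≤ deriv f r)
    (hf'' : ∀ r : ℝ, 0 < r → 0 ≤ deriv (deriv f) r)
    (u : EuclideanSpace ℝ (Fin 3) → ℂ)
    (hu : ContDiff ℝ (⊤ : ℕ∞) u) (hsupp : HasCompactSupport u)
    (h0 : (0 : EuclideanSpace ℝ (Fin 3)) ∉ tsupport u) :
    (- ∫ x : EuclideanSpace ℝ (Fin 3),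
        conj (u x) * doubleCommutator (fun y => f ‖y‖) u x).re ≥
      - ∫ x : EuclideanSpace ℝ (Fin 3), iteratedDeriv 4 f ‖x‖ * ‖u x‖ ^ 2 := by
  obtain ⟨δ, hδ, hball⟩ := Metric.isOpen_iff.1 (isClosed_tsupport u).isOpen_compl 0 h0
  have hnorm (x) (hx : x ∈ tsupport u) : δ ≤ ‖x‖ := by
    by_contra! hlt
    exact hball (by simpa using hlt) hx
  set c : ℝ := δ / 2
  have hc : 0 < c := half_pos hδ
  have hcx (x) (hx : x ∈ tsupport u) : c < ‖x‖ := (half_lt_self hδ).trans_le (hnorm x hx)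
  have hε : 0 < c ^ 2 := by positivity
  have hφ : ContDiffOn ℝ (4 : ℕ) (fun s => f (√s)) (Set.Ioi 0) :=
    hf.comp (fun s hs => (Real.contDiffAt_sqrt (Set.mem_Ioi.1 hs).ne').contDiffWithinAt)
      fun s hs => Real.sqrt_pos.2 hs
  obtain ⟨g, hg, hgf⟩ := exists_contDiff_eq_of_contDiffOn_Ioi hφ hε
  replace hg : ContDiff ℝ 4 g := hg
  have hfg : Set.EqOn f (fun r => g (r ^ 2)) (Set.Ioi c) := fun r hr => by
    have hr' : c < r := hr
    have hr0 : 0 < r := hc.trans hr'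
    simp only
    rw [hgf _ (by gcongr), Real.sqrt_sq hr0.le]
  have hder {r : ℝ} (hr : c < r) := derivs_comp_sq hg isOpen_Ioi hfg (Set.mem_Ioi.2 hr)
  have h1 : ContDiff ℝ 3 (deriv g) := hg.deriv'
  have h2 : ContDiff ℝ 2 (deriv (deriv g)) := h1.deriv'
  have hψ : ContDiffOn ℝ (1 : ℕ) (fun s => (2 * deriv g s + 4 * s * deriv (deriv g) s) / s)
      (Set.Ioi 0) :=
    ContDiffOn.div (((contDiff_const.mul (h1.of_le (by norm_num))).add
      ((contDiff_const.mul contDiff_id).mul (h2.of_le (by norm_num)))).contDiffOn)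
      contDiffOn_id fun s hs => (Set.mem_Ioi.1 hs).ne'
  obtain ⟨p, hp, hpg⟩ := exists_contDiff_eq_of_contDiffOn_Ioi hψ hε
  have sqrt_gt {s : ℝ} (hs : c ^ 2 < s) : c < √s := Real.lt_sqrt_of_sq_lt hs
  have main := radial_lower_bound_of_contDiff hε hg hp
    (fun s hs => by
      rw [hpg s hs, div_mul_cancel₀ _ (hε.trans hs).ne'])
    (fun s hs => by
      have hr := hc.trans (sqrt_gt hs)
      have h := hf' _ hr
      rw [(hder (sqrt_gt hs)).1, Real.sq_sqrt (hε.trans hs).le] at h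
      exact nonneg_of_mul_nonneg_right h (by positivity))
    (fun s hs => by
      have h := hf'' _ (hc.trans (sqrt_gt hs))
      rw [(hder (sqrt_gt hs)).2.1, Real.sq_sqrt (hε.trans hs).le] at h
      rw [hpg s hs]
      exact div_nonneg h (hε.trans hs).le)
    (contDiff_infty.1 hu 4) hsupp
    (fun x hx => by
      have := hcx x hx
      gcongr)
  have hD : doubleCommutator (fun y => f ‖y‖) u = doubleCommutator (fun y => g (‖y‖ ^ 2)) u :=
    doubleCommutator_congr fun x hx => hfg (hcx x hx)
  rw [hD]
  refine main.le.trans' (le_of_eq ?_)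
  congr 2
  ext x
  by_cases hx : x ∈ tsupport u
  · rw [(hder (hcx x hx)).2.2]
  · simp [image_eq_zero_of_notMem_tsupport hx]
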